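/- Let p, q, K, λ₁, λ₂, a₁, a₂ be real numbers with 1 ≤ p ≤ q, K ≥ 1, λ₁ > 0, λ₂ > 0, a₁ ≥ 0, a₂ ≥ 0, and suppose λ₁^p + a₁·λ₁^q = λ₂^p + a₂·λ₂^q. Assume that (a₁·λ₁^q ≤ K·λ₁^p or a₁ ≤ 2·a₂) and that (a₂·λ₂^q ≤ K·λ₂^p or a₂ ≤ 2·a₁). Then (4K)^(−1/p)·λ₁ ≤ λ₂ ≤ (4K)^(1/p)·λ₁. -/

import Mathlib

/-- At a common level of `t ↦ t ^ p + a * t ^ q`, the phase condition at `y` bounds `x ^ p`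
by `4 * K * y ^ p`. -/
theorem rpow_le_of_common_level {p q K x y a b : ℝ}
    (hp : 0 < p) (hpq : p ≤ q) (hK : 1 ≤ K) (hx : 0 < x) (hy : 0 < y) (ha : 0 ≤ a)
    (hlevel : x ^ p + a * x ^ q = y ^ p + b * y ^ q)
    (hcase : b * y ^ q ≤ K * y ^ p ∨ b ≤ 2 * a) :
    x ^ p ≤ 4 * K * y ^ p := by
  have hxp : 0 < x ^ p := Real.rpow_pos_of_pos hx p
  have hyp : 0 < y ^ p := Real.rpow_pos_of_pos hy p
  have hxq : 0 < x ^ q := Real.rpow_pos_of_pos hx q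
  have hyq : 0 < y ^ q := Real.rpow_pos_of_pos hy q
  have hKy : y ^ p ≤ K * y ^ p := le_mul_of_one_le_left hyp.le hK
  rcases hcase with h | h
  · linarith [mul_nonneg ha hxq.le]
  · by_contra! hlt
    have hyx : y ≤ x := (Real.rpow_le_rpow_iff hy.le hx.le hp).mp (by linarith)
    have hpow : 4 * y ^ q ≤ x ^ q := by
      have hsplit (t : ℝ) (ht : 0 < t) : t ^ q = t ^ p * t ^ (q - p) := by
        rw [← Real.rpow_add ht, add_sub_cancel]
      rw [hsplit y hy, hsplit x hx, ← mul_assoc]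
      exact mul_le_mul (by linarith) (Real.rpow_le_rpow hy.le hyx (by linarith))
        (Real.rpow_nonneg hy.le _) hxp.le
    have hby : b * y ^ q ≤ 2 * a * y ^ q := mul_le_mul_of_nonneg_right h hyq.le
    linarith [mul_le_mul_of_nonneg_left hpow ha, mul_nonneg ha hxq.le]

/-- Taking `p`-th roots in `x ^ p ≤ C * y ^ p`. -/
theorem le_rpow_one_div_mul_of_rpow_le {p C x y : ℝ} (hp : 0 < p) (hC : 0 ≤ C)
    (hx : 0 ≤ x) (hy : 0 ≤ y) (h : x ^ p ≤ C * y ^ p) : x ≤ C ^ (1 / p) * y := by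
  rw [← Real.rpow_le_rpow_iff hx (by positivity) hp,
    Real.mul_rpow (by positivity) hy, ← Real.rpow_mul hC, one_div_mul_cancel hp.ne',
    Real.rpow_one]
  exact h

/-- Two-sided comparison (eq : comparison condition of lambda_z_2 and _z_1):
under the common-level identity and either phase condition at each point,
`(4K)^(−1/p)·λ₁ ≤ λ₂ ≤ (4K)^(1/p)·λ₁`. -/
theorem stmt_14 (p q K lam₁ lam₂ a₁ a₂ : ℝ)
    (hp : 1 ≤ p) (hpq : p ≤ q) (hK : 1 ≤ K)
    (hl₁ : 0 < lam₁) (hl₂ : 0 < lam₂) (ha₁ : 0 ≤ a₁) (ha₂ : 0 ≤ a₂)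
    (hΛ : lam₁ ^ p + a₁ * lam₁ ^ q = lam₂ ^ p + a₂ * lam₂ ^ q)
    (hcase₁ : a₁ * lam₁ ^ q ≤ K * lam₁ ^ p ∨ a₁ ≤ 2 * a₂)
    (hcase₂ : a₂ * lam₂ ^ q ≤ K * lam₂ ^ p ∨ a₂ ≤ 2 * a₁) :
    (4 * K) ^ (-(1 / p)) * lam₁ ≤ lam₂ ∧ lam₂ ≤ (4 * K) ^ (1 / p) * lam₁ := by
  have hp0 : 0 < p := by linarith
  have hK0 : 0 < 4 * K := by linarith
  constructor
  · rw [Real.rpow_neg hK0.le, inv_mul_le_iff₀ (Real.rpow_pos_of_pos hK0 _)]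
    exact le_rpow_one_div_mul_of_rpow_le hp0 hK0.le hl₁.le hl₂.le
      (rpow_le_of_common_level hp0 hpq hK hl₁ hl₂ ha₁ hΛ hcase₂)
  · exact le_rpow_one_div_mul_of_rpow_le hp0 hK0.le hl₂.le hl₁.le
      (rpow_le_of_common_level hp0 hpq hK hl₂ hl₁ ha₂ hΛ.symm hcase₁)
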